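/- Let f : 𝔸 → 𝔸 be a homeomorphism of the annulus satisfying the twist condition and the intersection property, and suppose f restricted to each boundary circle is a rigid rotation (i.e., the boundary twist functions r₀(x) ≡ r₀ > 0 and r₁(x) ≡ r₁ > 0 are constant). Then there is a chain transitive component D of the chain recurrent set ℛ(f) such that D ∩ A₀ ≠ ∅ and D ∩ A₁ ≠ ∅. -/

import Mathlib

open Set Metric

noncomputable section

/-- The circle `S¹ = ℝ/ℤ`. -/
abbrev S1 : Type := AddCircle (1 : ℝ)

/-- The unit interval `[0,1]` as a type. -/
abbrev I01 : Type := Set.Icc (0 : ℝ) 1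

/-- The annulus `𝔸 = S¹ × [0,1]`. -/
abbrev Ann : Type := S1 × I01

def iZero : I01 := ⟨0, by norm_num⟩
def iOne : I01 := ⟨1, by norm_num⟩

/-- The boundary circle `A₀ = S¹ × {0}`. -/
def A0 : Set Ann := {p | p.2 = iZero}

/-- The boundary circle `A₁ = S¹ × {1}`. -/
def A1 : Set Ann := {p | p.2 = iOne}

/-- The covering map `ℝ × [0,1] → 𝔸`. -/
def annCover : ℝ × I01 → Ann := fun p => ((p.1 : S1), p.2)

/-- `F` is a lift of `f` through the covering map, commuting with the deck
transformation `(x,y) ↦ (x+1,y)`. -/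
def IsLift (f : Ann → Ann) (F : ℝ × I01 → ℝ × I01) : Prop :=
  (∀ p, annCover (F p) = f (annCover p)) ∧
  ∀ p : ℝ × I01, F (p.1 + 1, p.2) = ((F p).1 + 1, (F p).2)

/-- An essential simple closed curve in `Y`: a continuous injective map from the
circle which is not null-homotopic (not contractible). -/
def IsEssentialCurve {Y : Type*} [TopologicalSpace Y] (γ : C(S1, Y)) : Prop :=
  Function.Injective γ ∧ ¬ γ.Nullhomotopic

/-- `f` satisfies the intersection property if every essential simple closed curve
meets its image under `f`. -/
def IntersectionProperty {Y : Type*} [TopologicalSpace Y] (f : Y → Y) : Prop :=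
  ∀ γ : C(S1, Y), IsEssentialCurve γ → (f '' Set.range γ ∩ Set.range γ).Nonempty

/-- The twist condition: some lift `F` of `f` moves the two boundary lines in
opposite directions: `F(x,1) = (x + r₁ x, 1)`, `F(x,0) = (x - r₀ x, 0)` with
`r₀ x, r₁ x > 0`. -/
def TwistCondition (f : Ann → Ann) : Prop :=
  ∃ F : (ℝ × I01) ≃ₜ (ℝ × I01), IsLift f ⇑F ∧
    ∃ r₀ r₁ : ℝ → ℝ,
      (∀ x, 0 < r₀ x) ∧ (∀ x, 0 < r₁ x) ∧
      (∀ x : ℝ, F (x, iOne) = (x + r₁ x, iOne)) ∧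
      (∀ x : ℝ, F (x, iZero) = (x - r₀ x, iZero))

/-- An `ε`-chain for `f` from `p` to `q`: a finite sequence `c 0 = p, …, c n = q`
with `n ≥ 1` and `dist (f (c i)) (c (i+1)) < ε` for all `i < n`. -/
def EChain {X : Type*} [MetricSpace X] (f : X → X) (ε : ℝ) (p q : X) : Prop :=
  ∃ (n : ℕ) (c : ℕ → X), 0 < n ∧ c 0 = p ∧ c n = q ∧
    ∀ i < n, dist (f (c i)) (c (i + 1)) < ε

/-- A point is chain recurrent if for every `ε > 0` there is an `ε`-chain from it to itself. -/
def ChainRecurrent {X : Type*} [MetricSpace X] (f : X → X) (p : X) : Prop :=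
  ∀ ε > 0, EChain f ε p p

/-- The chain recurrent set `ℛ(f)`. -/
def chainRecSet {X : Type*} [MetricSpace X] (f : X → X) : Set X :=
  {p | ChainRecurrent f p}

/-- The equivalence relation `∼` on the chain recurrent set: `p ∼ q` iff for every
`ε > 0` there are `ε`-chains from `p` to `q` and from `q` to `p`. -/
def ChainEquiv {X : Type*} [MetricSpace X] (f : X → X) (p q : X) : Prop :=
  p ∈ chainRecSet f ∧ q ∈ chainRecSet f ∧
    ∀ ε > 0, EChain f ε p q ∧ EChain f ε q p

/-- The chain transitive component of a chain recurrent point `p`. -/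
def chainComponent {X : Type*} [MetricSpace X] (f : X → X) (p : X) : Set X :=
  {q | ChainEquiv f p q}

/-- A homotopy of loops in the circle from a loop whose lift has distinct endpoints
cannot end at a constant loop. -/
theorem no_homotopy_to_const (H : C(unitInterval × unitInterval, S1)) (g : C(unitInterval, ℝ))
    (c : S1) (hper : ∀ t, H (t, 0) = H (t, 1)) (h0 : ∀ s, H (0, s) = (g s : S1))
    (h1 : ∀ s, H (1, s) = c) : g 0 = g 1 := by
  have cov : IsCoveringMap ((↑) : ℝ → S1) := AddCircle.isCoveringMap_coe 1
  let L := cov.liftHomotopy H g h0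
  have hL : ∀ x, ((L x : ℝ) : S1) = H x := fun x =>
    congr_fun (cov.liftHomotopy_lifts H g h0) x
  have hL0 : ∀ s, L (0, s) = g s := cov.liftHomotopy_zero H g h0
  have e1 : (fun t => L (t, 1)) = fun t => L (t, 0) + (g 1 - g 0) := by
    refine cov.eq_of_comp_eq (by fun_prop) (by fun_prop) ?_ 0 (by simp [hL0])
    ext t
    have : ((g 1 : ℝ) : S1) = (g 0 : S1) := by rw [← h0, ← h0, hper]
    simp [hL, hper, this]
  have e2 : (fun s => L (1, s)) = fun _ => L (1, 0) := by
    refine cov.eq_of_comp_eq (by fun_prop) (by fun_prop) ?_ 0 rfl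
    ext s
    simp [hL, h1]
  have h2 : L (1, 1) = L (1, 0) + (g 1 - g 0) := congr_fun e1 1
  have h3 : L (1, 1) = L (1, 0) := congr_fun e2 1
  linarith

theorem not_nullhomotopic_of_lift (γ : C(S1, Ann)) (g : C(unitInterval, ℝ))
    (hg : ∀ s : unitInterval, (γ ((s : ℝ) : S1)).1 = (g s : S1)) (h : g 0 ≠ g 1) :
    ¬ γ.Nullhomotopic := by
  rintro ⟨y, ⟨K⟩⟩
  refine h (no_homotopy_to_const
    ⟨fun p => (K (p.1, ((p.2 : ℝ) : S1))).1, ?_⟩ g y.1 ?_ ?_ ?_)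
  · have : Continuous ((↑) : ℝ → S1) := AddCircle.continuous_mk' 1
    fun_prop
  · intro t
    have : ((1 : ℝ) : S1) = ((0 : ℝ) : S1) := by simp
    simp [this]
  · intro s
    simp [hg]
  · intro s
    simp

/-- Two integer points are joined by a horizontal or vertical unit segment. -/
def UnitStep (u v : ℤ × ℤ) : Prop :=
  (|u.1 - v.1| = 1 ∧ u.2 = v.2) ∨ (u.1 = v.1 ∧ |u.2 - v.2| = 1)

/-- The nearest-neighbour graph on `ℤ × ℤ` restricted to the vertices satisfying `a`. -/
def gridGraph (a : ℤ × ℤ → Prop) : SimpleGraph (ℤ × ℤ) where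
  Adj u v := a u ∧ a v ∧ UnitStep u v
  symm := ⟨fun u v ⟨hu, hv, h⟩ => ⟨hv, hu, by
    rw [UnitStep] at *; rw [abs_sub_comm v.1, abs_sub_comm v.2]; tauto⟩⟩
  loopless := ⟨fun u ⟨_, _, h⟩ => by simp [UnitStep] at h⟩

theorem gridGraph_reachable_add {a : ℤ × ℤ → Prop} {w : ℤ × ℤ} (ha : ∀ u, a u → a (u + w))
    {u v : ℤ × ℤ} (h : (gridGraph a).Reachable u v) :
    (gridGraph a).Reachable (u + w) (v + w) := by
  let F : gridGraph a →g gridGraph a :=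
    ⟨fun u => u + w, fun {u v} h => ⟨ha _ h.1, ha _ h.2.1, by simpa [UnitStep] using h.2.2⟩⟩
  exact h.map F

/-- If no vertex is connected to a nontrivial translate of itself by a multiple of `w`, the
connected components can be labelled by integers equivariantly under translation by `w`. -/
theorem exists_equivariant_label {a : ℤ × ℤ → Prop} {w : ℤ × ℤ}
    (ha : ∀ (m : ℤ) u, a u → a (u + m • w))
    (hno : ∀ (u : ℤ × ℤ) (d : ℤ), d ≠ 0 → ¬ (gridGraph a).Reachable u (u + d • w)) :
    ∃ k : ℤ × ℤ → ℤ, (∀ u v, (gridGraph a).Adj u v → k u = k v) ∧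
      ∀ u, k (u + w) = k u + 1 := by
  let G := gridGraph a
  have key : ∀ (m : ℤ) {u v}, G.Reachable u v → G.Reachable (u + m • w) (v + m • w) :=
    fun m u v h => gridGraph_reachable_add (ha m) h
  let S : Setoid (ℤ × ℤ) :=
    { r := fun u v => ∃ m : ℤ, G.Reachable u (v + m • w)
      iseqv := ⟨fun u => ⟨0, by simp⟩, fun {u v} ⟨m, h⟩ => ⟨-m, by
          have := (key (-m) h).symm
          rwa [add_assoc, ← add_smul, add_neg_cancel, zero_smul, add_zero] at this⟩,
        fun {u v x} ⟨m, h⟩ ⟨l, h'⟩ => ⟨l + m, by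
          have := h.trans (key m h')
          rwa [add_assoc, ← add_smul] at this⟩⟩ }
  let r : ℤ × ℤ → ℤ × ℤ := fun u => (Quotient.mk S u).out
  have hr : ∀ u, ∃ m : ℤ, G.Reachable u (r u + m • w) := fun u => by
    have : S.r u (r u) := S.symm (Quotient.mk_out (s := S) u)
    exact this
  have hr_eq : ∀ {u v}, S.r u v → r u = r v := fun {u v} h =>
    congrArg Quotient.out (Quotient.sound (s := S) h)
  choose k hk using hr
  have uniq : ∀ (x : ℤ × ℤ) (m l : ℤ), G.Reachable (x + m • w) (x + l • w) → m = l := by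
    intro x m l h
    by_contra hne
    refine hno (x + m • w) (l - m) (sub_ne_zero.2 (Ne.symm hne)) ?_
    rwa [add_assoc, ← add_smul, add_sub_cancel]
  refine ⟨k, fun u v h => ?_, fun u => ?_⟩
  · have huv : G.Reachable u v := h.reachable
    have e : r u = r v := hr_eq ⟨0, by simpa using huv⟩
    refine uniq (r v) _ _ ?_
    have := (hk u).symm.trans (huv.trans (hk v))
    rwa [e] at this
  · have e : r (u + w) = r u := hr_eq ⟨1, by simp⟩
    refine uniq (r u) _ _ ?_
    have h1 := (key 1 (hk u))
    rw [add_assoc, ← add_smul, one_smul] at h1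
    have := (hk (u + w)).symm.trans h1
    rwa [e] at this

/-- A shortest walk joining a vertex to a nontrivial translate of itself projects to a
simple cycle in the quotient by the translation. -/
theorem exists_simple_periodic_walk {a : ℤ × ℤ → Prop} {w : ℤ × ℤ}
    (h : ∃ (u : ℤ × ℤ) (d : ℤ), d ≠ 0 ∧ (gridGraph a).Reachable u (u + d • w)) :
    ∃ (n : ℕ) (v : ℕ → ℤ × ℤ) (d : ℤ), d ≠ 0 ∧ v n = v 0 + d • w ∧
      (∀ i < n, (gridGraph a).Adj (v i) (v (i + 1))) ∧
      ∀ i j, i < j → j ≤ n → ∀ m : ℤ, v j = v i + m • w → i = 0 ∧ j = n := by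
  classical
  let G := gridGraph a
  let P : ℕ → Prop := fun n => ∃ (u : ℤ × ℤ) (d : ℤ), d ≠ 0 ∧ ∃ p : G.Walk u (u + d • w),
    p.length = n
  have hP : ∃ n, P n := by
    obtain ⟨u, d, hd, ⟨p⟩⟩ := h
    exact ⟨_, u, d, hd, p, rfl⟩
  obtain ⟨u, d, hd, p, hp⟩ := Nat.find_spec hP
  have hmin : ∀ {u : ℤ × ℤ} {d : ℤ}, d ≠ 0 → ∀ q : G.Walk u (u + d • w),
      Nat.find hP ≤ q.length := fun hd q => Nat.find_min' hP ⟨_, _, hd, q, rfl⟩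
  have hpath : p.IsPath := by
    have : p.bypass = p := by
      refine p.bypass_eq_self_of_length_le_length_bypass ?_
      rw [hp]
      exact hmin hd _
    rw [← this]
    exact p.bypass_isPath
  refine ⟨p.length, p.getVert, d, hd, by simp, fun i hi => p.adj_getVert_succ hi, ?_⟩
  intro i j hij hj m hm
  by_cases hm0 : m = 0
  · subst hm0
    have := hpath.getVert_injOn (by simpa using hj) (by simpa using hij.le.trans hj)
      (by simpa using hm)
    omega
  · have q : ∃ q : G.Walk (p.getVert i) (p.getVert j), q.length = j - i := by
      have e : (p.take j).getVert i = p.getVert i := by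
        rw [SimpleGraph.Walk.take_getVert, min_eq_right hij.le]
      refine ⟨((p.take j).drop i).copy e rfl, ?_⟩
      simp [SimpleGraph.Walk.drop_length, SimpleGraph.Walk.take_length, hj]
    obtain ⟨q, hq⟩ := q
    have := hmin hm0 (q.copy rfl hm)
    simp only [SimpleGraph.Walk.length_copy] at this
    omega

/-- The piecewise affine interpolation of a sequence, on `[0, ∞)`. -/
def interp (c : ℕ → ℝ) (t : ℝ) : ℝ :=
  c ⌊t⌋₊ + (t - ⌊t⌋₊) * (c (⌊t⌋₊ + 1) - c ⌊t⌋₊)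

theorem interp_natCast (c : ℕ → ℝ) (n : ℕ) : interp c n = c n := by
  simp [interp]

theorem interp_eq_of_mem_Icc (c : ℕ → ℝ) (n : ℕ) {t : ℝ} (ht : t ∈ Icc (n : ℝ) (n + 1)) :
    interp c t = c n + (t - n) * (c (n + 1) - c n) := by
  rcases ht.2.eq_or_lt with h | h
  · have := interp_natCast c (n + 1)
    push_cast at this
    rw [h, this]
    ring
  · have : ⌊t⌋₊ = n := (Nat.floor_eq_iff (n.cast_nonneg.trans ht.1)).2 ⟨ht.1, h⟩
    simp [interp, this]

theorem continuousOn_interp (c : ℕ → ℝ) (n : ℕ) : ContinuousOn (interp c) (Icc 0 n) := by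
  induction n with
  | zero => simp
  | succ n ih =>
    have e : Icc (0 : ℝ) (n + 1 : ℕ) = Icc 0 (n : ℝ) ∪ Icc (n : ℝ) (n + 1) := by
      rw [Icc_union_Icc_eq_Icc n.cast_nonneg (by linarith)]
      push_cast
      rfl
    rw [e]
    refine ih.union_of_isClosed ?_ isClosed_Icc isClosed_Icc
    refine ContinuousOn.congr (f := fun t => c n + (t - n) * (c (n + 1) - c n)) (by fun_prop) ?_
    exact fun t ht => interp_eq_of_mem_Icc c n ht

/-- Two half-open unit edges of the integer grid meet only in their initial points, unless they
coincide or are opposite. -/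
theorem unitStep_meet {a a' b b' : ℤ × ℤ} (ha : UnitStep a a') (hb : UnitStep b b') {σ τ : ℝ}
    (hσ0 : 0 ≤ σ) (hσ1 : σ < 1) (hτ0 : 0 ≤ τ) (hτ1 : τ < 1)
    (h1 : (a.1 : ℝ) + σ * (a'.1 - a.1) = b.1 + τ * (b'.1 - b.1))
    (h2 : (a.2 : ℝ) + σ * (a'.2 - a.2) = b.2 + τ * (b'.2 - b.2)) :
    (a = b ∧ σ = τ) ∨ (a' = b ∧ b' = a) := by
  obtain ⟨a1, a2⟩ := a
  obtain ⟨c1, c2⟩ := a'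
  obtain ⟨b1, b2⟩ := b
  obtain ⟨d1, d2⟩ := b'
  simp only [UnitStep, Prod.mk.injEq] at *
  have parallel : ∀ {x y x' y' : ℤ}, |x - x'| = 1 → |y - y'| = 1 →
      (x : ℝ) + σ * (x' - x) = y + τ * (y' - y) →
      (x = y ∧ σ = τ) ∨ (x' = y ∧ y' = x) := by
    intro x y x' y' hx hy h
    have hx' : x' = x - 1 ∨ x' = x + 1 := by
      rcases (abs_eq zero_le_one).1 hx with h | h <;> omega
    have hy' : y' = y - 1 ∨ y' = y + 1 := by
      rcases (abs_eq zero_le_one).1 hy with h | h <;> omega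
    have l1 : (x : ℝ) < y + 2 := by
      rcases hx' with rfl | rfl <;> rcases hy' with rfl | rfl <;> push_cast at h <;> linarith
    have l2 : (y : ℝ) < x + 2 := by
      rcases hx' with rfl | rfl <;> rcases hy' with rfl | rfl <;> push_cast at h <;> linarith
    have l1' : x < y + 2 := by exact_mod_cast l1
    have l2' : y < x + 2 := by exact_mod_cast l2
    have : x = y ∨ x = y + 1 ∨ x = y - 1 := by omega
    rcases this with rfl | rfl | rfl <;> rcases hx' with rfl | rfl <;>
      rcases hy' with rfl | rfl <;> push_cast at h <;>
      first
      | exact Or.inl ⟨rfl, by linarith⟩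
      | exact Or.inr ⟨by omega, by omega⟩
      | exact absurd h (by intro h; linarith)
  have perp : ∀ {x y x' : ℤ} {ρ : ℝ}, 0 ≤ ρ → ρ < 1 → |x - x'| = 1 →
      (x : ℝ) + ρ * (x' - x) = y → x = y ∧ ρ = 0 := by
    intro x y x' ρ h0 h1 hx h
    have hx' : x' = x - 1 ∨ x' = x + 1 := by
      rcases (abs_eq zero_le_one).1 hx with h | h <;> omega
    have l1 : (x : ℝ) < y + 1 := by
      rcases hx' with rfl | rfl <;> push_cast at h <;> linarith
    have l2 : (y : ℝ) < x + 1 := by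
      rcases hx' with rfl | rfl <;> push_cast at h <;> linarith
    have l1' : x < y + 1 := by exact_mod_cast l1
    have l2' : y < x + 1 := by exact_mod_cast l2
    have : x = y := by omega
    subst this
    refine ⟨rfl, ?_⟩
    rcases hx' with rfl | rfl <;> push_cast at h <;> linarith
  rcases ha with ⟨ha, rfl⟩ | ⟨rfl, ha⟩ <;> rcases hb with ⟨hb, rfl⟩ | ⟨rfl, hb⟩
  · simp only [sub_self, mul_zero, add_zero, Int.cast_inj] at h2
    rcases parallel ha hb h1 with ⟨h, h'⟩ | ⟨h, h'⟩ <;> simp [*]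
  · simp only [sub_self, mul_zero, add_zero] at h1 h2
    obtain ⟨rfl, rfl⟩ := perp hσ0 hσ1 ha h1
    obtain ⟨rfl, rfl⟩ := perp hτ0 hτ1 hb h2.symm
    simp
  · simp only [sub_self, mul_zero, add_zero] at h1 h2
    obtain ⟨rfl, rfl⟩ := perp hσ0 hσ1 ha h2
    obtain ⟨rfl, rfl⟩ := perp hτ0 hτ1 hb h1.symm
    simp
  · simp only [sub_self, mul_zero, add_zero, Int.cast_inj] at h1
    rcases parallel ha hb h2 with ⟨h, h'⟩ | ⟨h, h'⟩ <;> simp [*]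

/-- The polygonal curve through the vertices of a walk that is simple modulo horizontal
translation by `N` is itself simple modulo this translation. -/
theorem interp_injOn {N : ℤ} (hN : 3 ≤ N) {n : ℕ} {v : ℕ → ℤ × ℤ} {d : ℤ} (hd : d ≠ 0)
    (hv : v n = v 0 + d • (N, 0)) (hstep : ∀ i < n, UnitStep (v i) (v (i + 1)))
    (hsimple : ∀ i j, i < j → j ≤ n → ∀ m : ℤ, v j = v i + m • (N, 0) → i = 0 ∧ j = n)
    {s t : ℝ} (hs : s ∈ Ico 0 (n : ℝ)) (ht : t ∈ Ico 0 (n : ℝ)) (m : ℤ)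
    (h1 : interp (fun k => (v k).1) s = interp (fun k => (v k).1) t + m * N)
    (h2 : interp (fun k => (v k).2) s = interp (fun k => (v k).2) t) : s = t := by
  have bound : ∀ i ≤ n, |(v i).1 - (v 0).1| ≤ i := by
    intro i
    induction i with
    | zero => simp
    | succ i ih =>
      intro hi
      have h := ih (by omega)
      have := hstep i (by omega)
      have h' : |(v i).1 - (v (i + 1)).1| ≤ 1 := by
        rcases this with ⟨h, -⟩ | ⟨h, -⟩
        · exact h.le
        · simp [h]
      rw [abs_le] at *
      push_cast
      omega
  have hn : 3 ≤ n := by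
    have h := bound n le_rfl
    have e : (v n).1 - (v 0).1 = d * N := by simp [hv]
    rw [e, abs_mul] at h
    have h1 : 1 ≤ |d| := Int.one_le_abs hd
    have h2 : 3 ≤ |N| := hN.trans (le_abs_self N)
    have : (3 : ℤ) ≤ n := by nlinarith
    exact_mod_cast this
  set k := ⌊s⌋₊ with hk
  set l := ⌊t⌋₊ with hl
  have hkn : k < n := (Nat.floor_lt hs.1).2 hs.2
  have hln : l < n := (Nat.floor_lt ht.1).2 ht.2
  have step_add : ∀ {u u' : ℤ × ℤ} (w : ℤ × ℤ), UnitStep u u' → UnitStep (u + w) (u' + w) := by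
    intro u u' w h
    simpa [UnitStep] using h
  have hs1 := Nat.floor_le hs.1
  have hs2 := Nat.lt_floor_add_one s
  have ht1 := Nat.floor_le ht.1
  have ht2 := Nat.lt_floor_add_one t
  rw [← hk] at hs1 hs2
  rw [← hl] at ht1 ht2
  simp only [interp, ← hk, ← hl] at h1 h2
  have := unitStep_meet (hstep k hkn) (step_add (m • (N, 0)) (hstep l hln))
    (σ := s - k) (τ := t - l) (by linarith) (by linarith) (by linarith) (by linarith)
    (by simp; linarith) (by simp; linarith)
  rcases this with ⟨h, h'⟩ | ⟨h, h'⟩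
  · rcases lt_trichotomy k l with hlt | heq | hlt
    · have := hsimple k l hlt hln.le (-m) (by rw [h, neg_smul, add_neg_cancel_right])
      omega
    · rw [heq] at h'
      linarith
    · have := hsimple l k hlt hkn.le m h
      omega
  · have c1 : k + 1 = l ∨ (l = 0 ∧ k + 1 = n) := by
      rcases lt_trichotomy (k + 1) l with hlt | heq | hlt
      · have := hsimple (k + 1) l hlt hln.le (-m) (by rw [h, neg_smul, add_neg_cancel_right])
        omega
      · exact Or.inl heq
      · exact Or.inr (hsimple l (k + 1) hlt hkn m h)
    have c2 : l + 1 = k ∨ (k = 0 ∧ l + 1 = n) := by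
      rcases lt_trichotomy (l + 1) k with hlt | heq | hlt
      · have := hsimple (l + 1) k hlt hkn.le m h'.symm
        omega
      · exact Or.inl heq
      · exact Or.inr (hsimple k (l + 1) hlt hln (-m) (by rw [← h', neg_smul, add_neg_cancel_right]))
    omega

theorem dist_coe_le (x y : ℝ) : dist (x : S1) (y : S1) ≤ |x - y| := by
  rw [dist_eq_norm, ← AddCircle.coe_sub]
  exact QuotientAddGroup.norm_mk_le_norm

/-- The point of the annulus with coordinates `(x / N, y / N)`, the second one being clamped
to `[0, 1]`. -/
def annPt (N : ℕ) (x y : ℝ) : Ann := (((x / N : ℝ) : S1), projIcc 0 1 zero_le_one (y / N))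

theorem continuous_annPt (N : ℕ) : Continuous fun p : ℝ × ℝ => annPt N p.1 p.2 := by
  have : Continuous ((↑) : ℝ → S1) := AddCircle.continuous_mk' 1
  unfold annPt
  exact (this.comp (by fun_prop)).prodMk (continuous_projIcc.comp (by fun_prop))

theorem annPt_add_mul {N : ℕ} (hN : N ≠ 0) (m : ℤ) (x y : ℝ) :
    annPt N (x + m * N) y = annPt N x y := by
  have : (x + m * N) / N = x / N + m := by field_simp
  simp [annPt, this]

theorem exists_annPt_modulus (φ : C(Ann, ℝ)) {ε : ℝ} (hε : 0 < ε) :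
    ∃ N : ℕ, 3 ≤ N ∧ ∀ x y x' y' : ℝ, |x - x'| ≤ 2 → |y - y'| ≤ 2 →
      |φ (annPt N x y) - φ (annPt N x' y')| < ε := by
  obtain ⟨δ, hδ, h⟩ := Metric.uniformContinuous_iff.1
    (CompactSpace.uniformContinuous_of_continuous φ.continuous) ε hε
  obtain ⟨N, hN⟩ := exists_nat_gt (max (2 / δ) 3)
  have h3 : (3 : ℝ) < N := (le_max_right _ _).trans_lt hN
  have h2 : 2 / N < δ := by
    rw [div_lt_comm₀ (by linarith) hδ]
    exact (le_max_left _ _).trans_lt hN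
  have hdiv : ∀ {x x' : ℝ}, |x - x'| ≤ 2 → |x / N - x' / N| < δ := fun {x x'} hx => by
    rw [← sub_div, abs_div, Nat.abs_cast]
    exact (div_le_div_of_nonneg_right hx (by linarith)).trans_lt h2
  refine ⟨N, by exact_mod_cast h3.le, fun x y x' y' hx hy => ?_⟩
  have := @h (annPt N x y) (annPt N x' y') ?_
  · rwa [Real.dist_eq] at this
  · rw [Prod.dist_eq, max_lt_iff]
    refine ⟨(dist_coe_le _ _).trans_lt (hdiv hx), ?_⟩
    have := (LipschitzWith.projIcc (zero_le_one' ℝ)).dist_le_mul (y / N) (y' / N)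
    rw [NNReal.coe_one, one_mul, Real.dist_eq] at this
    exact this.trans_lt (hdiv hy)

/-- The closed polygonal curve of a simple periodic grid walk contained in a region is an
essential simple closed curve. -/
theorem exists_essentialCurve_of_walk {φ : C(Ann, ℝ)} {N : ℕ} (hN : 3 ≤ N)
    (h0 : ∀ x, φ (x, iZero) = 1) (h1 : ∀ x, φ (x, iOne) = 0)
    (hφ : ∀ x y x' y' : ℝ, |x - x'| ≤ 2 → |y - y'| ≤ 2 →
      |φ (annPt N x y) - φ (annPt N x' y')| < 1 / 8)
    {n : ℕ} {v : ℕ → ℤ × ℤ} {d : ℤ} (hd : d ≠ 0) (hv : v n = v 0 + d • ((N : ℤ), 0))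
    (hvφ : ∀ i < n, 1 / 8 < φ (annPt N (v i).1 (v i).2) ∧ φ (annPt N (v i).1 (v i).2) < 7 / 8)
    (hstep : ∀ i < n, UnitStep (v i) (v (i + 1)))
    (hsimple : ∀ i j, i < j → j ≤ n → ∀ m : ℤ, v j = v i + m • ((N : ℤ), 0) → i = 0 ∧ j = n) :
    ∃ γ : C(S1, Ann), IsEssentialCurve γ ∧ ∀ θ, 0 < φ (γ θ) ∧ φ (γ θ) < 1 := by
  set X : ℝ → ℝ := interp fun k => (v k).1 with hX
  set Y : ℝ → ℝ := interp fun k => (v k).2 with hY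
  have hN0 : (0 : ℝ) < N := by exact_mod_cast (by omega : 0 < N)
  have hn0 : 0 < n := by
    rcases Nat.eq_zero_or_pos n with rfl | h
    · exfalso
      have : d * N = 0 := by simpa using hv
      rcases mul_eq_zero.1 this with h | h
      · exact hd h
      · omega
    · exact h
  have hn0' : (0 : ℝ) < n := by exact_mod_cast hn0
  have hX0 : X 0 = (v 0).1 := by simpa using interp_natCast (fun k => ((v k).1 : ℝ)) 0
  have hY0 : Y 0 = (v 0).2 := by simpa using interp_natCast (fun k => ((v k).2 : ℝ)) 0
  have hXn : X n = X 0 + d * N := by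
    rw [hX0, hX, interp_natCast, hv]
    simp
  have hYn : Y n = Y 0 := by
    rw [hY0, hY, interp_natCast, hv]
    simp
  have hmaps : MapsTo (fun s : ℝ => n * s) (Icc 0 1) (Icc 0 (n : ℝ)) := fun s hs =>
    ⟨mul_nonneg hn0'.le hs.1, mul_le_of_le_one_right hn0'.le hs.2⟩
  have hXc : ContinuousOn (fun s => X (n * s)) (Icc 0 1) :=
    (continuousOn_interp _ n).comp (by fun_prop) hmaps
  have hYc : ContinuousOn (fun s => Y (n * s)) (Icc 0 1) :=
    (continuousOn_interp _ n).comp (by fun_prop) hmaps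
  let P : ℝ → Ann := fun s => annPt N (X (n * s)) (Y (n * s))
  have hP01 : P 0 = P 1 := by
    simp only [P, mul_zero, mul_one, hXn, hYn]
    exact (annPt_add_mul (by omega) d _ _).symm
  have hPc : ContinuousOn P (Icc 0 1) :=
    (continuous_annPt N).comp_continuousOn (hXc.prodMk hYc)
  let γ : C(S1, Ann) := ⟨AddCircle.liftIco 1 0 P, AddCircle.liftIco_zero_continuous hP01 hPc⟩
  have hγ : ∀ s ∈ Ico (0 : ℝ) 1, γ (s : S1) = P s := fun s hs =>
    AddCircle.liftIco_zero_coe_apply (f := P) hs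
  have hγ' : ∀ s ∈ Icc (0 : ℝ) 1, γ (s : S1) = P s := fun s hs => by
    rcases hs.2.eq_or_lt with rfl | h
    · rw [← hP01, ← hγ 0 (by simp)]
      exact congrArg γ (by simp : ((1 : ℝ) : S1) = ((0 : ℝ) : S1))
    · exact hγ s ⟨hs.1, h⟩
  have hsurj : ∀ θ : S1, ∃ s ∈ Ico (0 : ℝ) 1, (s : S1) = θ := fun θ => by
    have : θ ∈ ((↑) : ℝ → S1) '' Ico 0 (0 + 1) := by
      rw [AddCircle.coe_image_Ico_eq]
      trivial
    simpa using this
  have near : ∀ (u u' : ℤ) (t : ℝ) (i : ℕ), t ∈ Icc (i : ℝ) (i + 1) → |u - u'| ≤ 1 →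
      |(u : ℝ) + (t - i) * (u' - u) - u| ≤ 2 := by
    intro u u' t i ht hu
    rw [abs_sub_comm] at hu
    have : |(u' : ℝ) - u| ≤ 1 := by exact_mod_cast hu
    rw [add_sub_cancel_left, abs_mul]
    have : |t - i| ≤ 1 := by
      rw [abs_le]
      constructor <;> linarith [ht.1, ht.2]
    nlinarith [abs_nonneg (t - i), abs_nonneg ((u' : ℝ) - u)]
  have hPφ : ∀ s ∈ Ico (0 : ℝ) 1, 0 < φ (P s) ∧ φ (P s) < 1 := by
    intro s hs
    have ht0 : 0 ≤ n * s := mul_nonneg hn0'.le hs.1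
    have ht1 : n * s < n := mul_lt_of_lt_one_right hn0' hs.2
    set t := n * s with ht
    set i := ⌊t⌋₊ with hi
    have hin : i < n := (Nat.floor_lt ht0).2 ht1
    have hti : t ∈ Icc (i : ℝ) (i + 1) := ⟨Nat.floor_le ht0, (Nat.lt_floor_add_one t).le⟩
    have hst : |(v i).1 - (v (i + 1)).1| ≤ 1 ∧ |(v i).2 - (v (i + 1)).2| ≤ 1 := by
      rcases hstep i hin with ⟨h, h'⟩ | ⟨h, h'⟩ <;> simp [h, h']
    have e : |φ (P s) - φ (annPt N (v i).1 (v i).2)| < 1 / 8 := by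
      apply hφ
      · rw [← ht, hX, interp_eq_of_mem_Icc _ i hti]
        exact near _ _ _ _ hti hst.1
      · rw [← ht, hY, interp_eq_of_mem_Icc _ i hti]
        exact near _ _ _ _ hti hst.2
    rw [abs_lt] at e
    have := hvφ i hin
    constructor <;> linarith [this.1, this.2, e.1, e.2]
  have hYmem : ∀ s ∈ Ico (0 : ℝ) 1, Y (n * s) / N ∈ Icc (0 : ℝ) 1 := by
    intro s hs
    by_contra hne
    have h := hPφ s hs
    rw [mem_Icc, not_and_or, not_le, not_le] at hne
    rcases hne with hne | hne
    · have : projIcc (0 : ℝ) 1 zero_le_one (Y (n * s) / N) = iZero :=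
        projIcc_of_le_left _ hne.le
      simp only [P, annPt, this, h0] at h
      linarith [h.2]
    · have : projIcc (0 : ℝ) 1 zero_le_one (Y (n * s) / N) = iOne :=
        projIcc_of_right_le _ hne.le
      simp only [P, annPt, this, h1] at h
      linarith [h.1]
  refine ⟨γ, ⟨?_, ?_⟩, ?_⟩
  · intro θ θ' h
    obtain ⟨s, hs, rfl⟩ := hsurj θ
    obtain ⟨t, ht, rfl⟩ := hsurj θ'
    rw [hγ s hs, hγ t ht] at h
    have hx := congrArg Prod.fst h
    have hy := congrArg Prod.snd h
    simp only [P, annPt] at hx hy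
    have hy' : Y (n * s) = Y (n * t) := by
      rw [projIcc_of_mem _ (hYmem s hs), projIcc_of_mem _ (hYmem t ht), Subtype.mk.injEq] at hy
      field_simp at hy
      exact hy
    obtain ⟨m, hm⟩ : ∃ m : ℤ, X (n * s) = X (n * t) + m * N := by
      rw [← sub_eq_zero, ← AddCircle.coe_sub, AddCircle.coe_eq_zero_iff] at hx
      obtain ⟨m, hm⟩ := hx
      refine ⟨m, ?_⟩
      simp only [zsmul_eq_mul, mul_one] at hm
      rw [hm]
      field_simp
      ring
    have hmem : ∀ s ∈ Ico (0 : ℝ) 1, n * s ∈ Ico (0 : ℝ) n := fun s hs =>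
      ⟨mul_nonneg hn0'.le hs.1, mul_lt_of_lt_one_right hn0' hs.2⟩
    have := interp_injOn (N := N) (by exact_mod_cast hN) hd hv hstep hsimple (hmem s hs)
      (hmem t ht) m (by exact_mod_cast hm) hy'
    rw [mul_left_cancel₀ hn0'.ne' this]
  · refine not_nullhomotopic_of_lift γ
      ⟨fun s => X (n * s) / N, (hXc.comp_continuous continuous_subtype_val
        fun s => s.2).div_const _⟩ ?_ ?_
    · intro s
      rw [hγ' s s.2]
      rfl
    · simp [hXn, hN0.ne', add_div, hd]
  · intro θ
    obtain ⟨s, hs, rfl⟩ := hsurj θ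
    rw [hγ s hs]
    exact hPφ s hs

/-- If no grid walk in the intermediate region winds around the annulus, then the function
separating the two boundary circles would yield a null-homotopy of the core circle. -/
theorem exists_winding_walk {φ : C(Ann, ℝ)} {N : ℕ} (hN : 3 ≤ N)
    (h0 : ∀ x, φ (x, iZero) = 1) (h1 : ∀ x, φ (x, iOne) = 0)
    (hφ : ∀ x y x' y' : ℝ, |x - x'| ≤ 2 → |y - y'| ≤ 2 →
      |φ (annPt N x y) - φ (annPt N x' y')| < 1 / 8) :
    ∃ (u : ℤ × ℤ) (d : ℤ), d ≠ 0 ∧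
      (gridGraph fun v => 1 / 8 < φ (annPt N v.1 v.2) ∧ φ (annPt N v.1 v.2) < 7 / 8).Reachable
        u (u + d • ((N : ℤ), 0)) := by
  by_contra! hno
  set a : ℤ × ℤ → Prop :=
    fun v => 1 / 8 < φ (annPt N v.1 v.2) ∧ φ (annPt N v.1 v.2) < 7 / 8 with ha
  have hN0 : (0 : ℝ) < N := by exact_mod_cast (by omega : 0 < N)
  obtain ⟨k, hk, hkN⟩ := exists_equivariant_label (a := a) (w := ((N : ℤ), 0)) (by
    intro m u hu
    have : annPt N ((u.1 + m * N : ℤ) : ℝ) u.2 = annPt N u.1 u.2 := by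
      push_cast
      exact annPt_add_mul (by omega) m _ _
    simp only [ha, Prod.smul_mk, smul_eq_mul, Prod.fst_add, Prod.snd_add, mul_zero, add_zero,
      this]
    exact hu) hno
  let K : ℝ × ℝ → ℤ := fun p => k (⌊p.1⌋, ⌊p.2⌋)
  let ψ : ℝ × ℝ → ℝ := fun p => φ (annPt N p.1 p.2)
  have hψ : Continuous ψ := φ.continuous.comp (continuous_annPt N)
  have floor_near : ∀ {x x' : ℝ}, |x' - x| < 1 →
      |x - ⌊x⌋| ≤ 2 ∧ |x - ⌊x'⌋| ≤ 2 ∧ (⌊x⌋ = ⌊x'⌋ ∨ |⌊x⌋ - ⌊x'⌋| = 1) := by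
    intro x x' h
    rw [abs_lt] at h
    have a1 := Int.floor_le x
    have a2 := Int.lt_floor_add_one x
    have b1 := Int.floor_le x'
    have b2 := Int.lt_floor_add_one x'
    refine ⟨abs_le.2 ⟨by linarith, by linarith⟩, abs_le.2 ⟨by linarith, by linarith⟩, ?_⟩
    have c1 : (⌊x⌋ : ℝ) < ⌊x'⌋ + 2 := by linarith
    have c2 : (⌊x'⌋ : ℝ) < ⌊x⌋ + 2 := by linarith
    have c1' : ⌊x⌋ < ⌊x'⌋ + 2 := by exact_mod_cast c1
    have c2' : ⌊x'⌋ < ⌊x⌋ + 2 := by exact_mod_cast c2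
    rcases eq_or_ne ⌊x⌋ ⌊x'⌋ with h | h
    · exact Or.inl h
    · right
      rw [abs_eq zero_le_one]
      omega
  have hK : ∀ p q : ℝ × ℝ, 1 / 4 < ψ p → ψ p < 3 / 4 → dist q p < 1 → K q = K p := by
    intro p q hp hp' hq
    rw [Prod.dist_eq, max_lt_iff, Real.dist_eq, Real.dist_eq] at hq
    obtain ⟨x1, x2, x3⟩ := floor_near hq.1
    obtain ⟨y1, y2, y3⟩ := floor_near hq.2
    have allowed : ∀ i j : ℤ, |p.1 - i| ≤ 2 → |p.2 - j| ≤ 2 → a (i, j) := by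
      intro i j hi hj
      have := hφ _ _ _ _ hi hj
      rw [abs_lt] at this
      constructor <;> dsimp only [ψ] at hp hp' ⊢ <;> linarith [this.1, this.2]
    have e1 : k (⌊p.1⌋, ⌊p.2⌋) = k (⌊q.1⌋, ⌊p.2⌋) := by
      rcases x3 with h | h
      · rw [h]
      · exact hk _ _ ⟨allowed _ _ x1 y1, allowed _ _ x2 y1, Or.inl ⟨h, rfl⟩⟩
    have e2 : k (⌊q.1⌋, ⌊p.2⌋) = k (⌊q.1⌋, ⌊q.2⌋) := by
      rcases y3 with h | h
      · rw [h]
      · exact hk _ _ ⟨allowed _ _ x2 y1, allowed _ _ x2 y2, Or.inr ⟨rfl, h⟩⟩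
    exact (e1.trans e2).symm
  let χ : ℝ → ℝ := fun r => max 0 (min 1 (4 * r - 3 / 2))
  have hχ : Continuous χ := by fun_prop
  have hχ0 : ∀ r < 3 / 8, χ r = 0 := fun r hr =>
    max_eq_left ((min_le_right _ _).trans (by linarith))
  have hχ1 : ∀ r, 5 / 8 < r → χ r = 1 := fun r hr => by
    simp only [χ]
    rw [min_eq_left (by linarith), max_eq_right zero_le_one]
  have intCoe : ∀ m : ℤ, ((m : ℝ) : S1) = 0 := fun m =>
    (AddCircle.coe_eq_zero_iff 1).2 ⟨m, by simp⟩
  have hcoe : Continuous ((↑) : ℝ → S1) := AddCircle.continuous_mk' 1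
  let h : ℝ × ℝ → S1 := fun p =>
    ((χ (ψ p) * (p.1 / N) + (1 - χ (ψ p)) * K p : ℝ) : S1)
  have hcont : Continuous h := by
    rw [continuous_iff_continuousAt]
    intro p
    rcases lt_or_ge (ψ p) (3 / 8) with hlt | hge
    · refine (continuousAt_const (y := (0 : S1))).congr ?_
      filter_upwards [hψ.continuousAt.eventually (gt_mem_nhds hlt)] with q hq
      simp [h, hχ0 _ hq, intCoe]
    rcases lt_or_ge (5 / 8) (ψ p) with hlt | hle
    · have : Continuous fun q : ℝ × ℝ => ((q.1 / N : ℝ) : S1) := hcoe.comp (by fun_prop)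
      refine this.continuousAt.congr ?_
      filter_upwards [hψ.continuousAt.eventually (lt_mem_nhds hlt)] with q hq
      simp [h, hχ1 _ hq]
    · have : Continuous fun q : ℝ × ℝ =>
          ((χ (ψ q) * (q.1 / N) + (1 - χ (ψ q)) * K p : ℝ) : S1) := hcoe.comp (by fun_prop)
      refine this.continuousAt.congr ?_
      filter_upwards [ball_mem_nhds p one_pos] with q hq
      simp only [h]
      rw [hK p q (by linarith) (by linarith) hq]
  have hψ0 : ∀ x, ψ (x, 0) = 1 := fun x => by
    have : projIcc (0 : ℝ) 1 zero_le_one (0 / N) = iZero := projIcc_of_le_left _ (by simp)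
    simp only [ψ, annPt, this, h0]
  have hψ1 : ∀ x, ψ (x, N) = 0 := fun x => by
    have : projIcc (0 : ℝ) 1 zero_le_one (N / N) = iOne :=
      projIcc_of_right_le _ (by rw [div_self hN0.ne'])
    simp only [ψ, annPt, this, h1]
  have := no_homotopy_to_const
    ⟨fun p => h (N * (p.2 : ℝ), N * (p.1 : ℝ)), hcont.comp (by fun_prop)⟩
    ⟨fun s => (s : ℝ), by fun_prop⟩ 0 ?_ ?_ ?_
  · simp at this
  · intro t
    have e1 : ψ (N, N * (t : ℝ)) = ψ (0, N * (t : ℝ)) := by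
      have := annPt_add_mul (N := N) (by omega) 1 0 (N * t)
      simp only [Int.cast_one, one_mul, zero_add] at this
      simp only [ψ, this]
    have e2 : K (N, N * (t : ℝ)) = K (0, N * (t : ℝ)) + 1 := by
      have := hkN (0, ⌊N * (t : ℝ)⌋)
      simpa [K] using this
    simp only [h, ContinuousMap.coe_mk, Set.Icc.coe_zero, Set.Icc.coe_one, mul_zero, mul_one, e1,
      e2]
    rw [← sub_eq_zero, ← AddCircle.coe_sub]
    convert! intCoe (-1) using 2
    push_cast
    field_simp
    ring
  · intro s
    simp only [h, ContinuousMap.coe_mk, Set.Icc.coe_zero, mul_zero, hψ0, hχ1 1 (by norm_num)]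
    congr 1
    field_simp
    ring
  · intro s
    simp only [h, ContinuousMap.coe_mk, Set.Icc.coe_one, mul_one, hψ1, hχ0 0 (by norm_num)]
    simp [intCoe]

/-- A continuous function separating the two boundary circles takes intermediate values along
some essential simple closed curve. -/
theorem exists_essentialCurve_between (φ : C(Ann, ℝ)) (h0 : ∀ x, φ (x, iZero) = 1)
    (h1 : ∀ x, φ (x, iOne) = 0) :
    ∃ γ : C(S1, Ann), IsEssentialCurve γ ∧ ∀ θ, 0 < φ (γ θ) ∧ φ (γ θ) < 1 := by
  obtain ⟨N, hN, hφ⟩ := exists_annPt_modulus φ (ε := 1 / 8) (by norm_num)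
  obtain ⟨n, v, d, hd, hv, hadj, hsimple⟩ :=
    exists_simple_periodic_walk (exists_winding_walk hN h0 h1 hφ)
  exact exists_essentialCurve_of_walk hN h0 h1 hφ hd hv (fun i hi => (hadj i hi).1)
    (fun i hi => (hadj i hi).2.2) hsimple

/-- A homeomorphism with the intersection property has no attracting or repelling essential
annulus separating the boundary circles. -/
theorem IntersectionProperty.false_of_trapping {f : Ann → Ann} (hf : Continuous f)
    (hint : IntersectionProperty f) {U : Set Ann} (hU : IsOpen U)
    (htrap : f '' closure U ⊆ U)
    (h : (A0 ⊆ f '' closure U ∧ A1 ⊆ Uᶜ) ∨ (A1 ⊆ f '' closure U ∧ A0 ⊆ Uᶜ)) : False := by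
  set C := f '' closure U with hC
  have hCc : IsClosed C := (isClosed_closure.isCompact.image hf).isClosed
  have hdisj : Disjoint C Uᶜ := disjoint_compl_right_iff_subset.2 htrap
  have key : ∀ γ : C(S1, Ann), IsEssentialCurve γ → (∀ θ, γ θ ∉ C ∧ γ θ ∉ Uᶜ) → False := by
    intro γ hγ hmem
    obtain ⟨-, ⟨-, ⟨θ, rfl⟩, rfl⟩, ⟨θ', h'⟩⟩ := hint γ hγ
    refine (hmem θ').1 (h' ▸ ⟨γ θ, subset_closure ?_, rfl⟩)
    simpa using (hmem θ).2
  rcases h with ⟨hA, hB⟩ | ⟨hA, hB⟩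
  · obtain ⟨φ, φ0, φ1, -⟩ := exists_continuous_zero_one_of_isClosed hU.isClosed_compl hCc
      hdisj.symm
    obtain ⟨γ, hγ, hmem⟩ := exists_essentialCurve_between φ (fun x => φ1 (hA rfl))
      (fun x => φ0 (hB rfl))
    exact key γ hγ fun θ => ⟨fun hθ => (hmem θ).2.ne (φ1 hθ), fun hθ => (hmem θ).1.ne' (φ0 hθ)⟩
  · obtain ⟨φ, φ0, φ1, -⟩ := exists_continuous_zero_one_of_isClosed hCc hU.isClosed_compl
      hdisj
    obtain ⟨γ, hγ, hmem⟩ := exists_essentialCurve_between φ (fun x => φ1 (hB rfl))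
      (fun x => φ0 (hA rfl))
    exact key γ hγ fun θ => ⟨fun hθ => (hmem θ).1.ne' (φ0 hθ), fun hθ => (hmem θ).2.ne (φ1 hθ)⟩

theorem EChain.trans {X : Type*} [MetricSpace X] {f : X → X} {ε : ℝ} {p q r : X}
    (h : EChain f ε p q) (h' : EChain f ε q r) : EChain f ε p r := by
  obtain ⟨n, c, hn, h0, hc, hd⟩ := h
  obtain ⟨m, c', hm, h0', hc', hd'⟩ := h'
  refine ⟨n + m, fun i => if i ≤ n then c i else c' (i - n), by omega, by simp [h0], ?_, ?_⟩
  · simp [hm.ne', hc']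
  · intro i hi
    rcases lt_trichotomy i n with hlt | rfl | hlt
    · simpa [hlt.le, Nat.succ_le_of_lt hlt] using hd i hlt
    · simpa [hc, ← h0'] using hd' 0 hm
    · have := hd' (i - n) (by omega)
      dsimp only
      rw [if_neg (by omega), if_neg (by omega)]
      rwa [show i + 1 - n = i - n + 1 by omega]

theorem EChain.single {X : Type*} [MetricSpace X] {f : X → X} {ε : ℝ} {p q : X}
    (h : dist (f p) q < ε) : EChain f ε p q :=
  ⟨1, fun i => if i = 0 then p else q, one_pos, by simp, by simp, fun i hi => by
    obtain rfl : i = 0 := by omega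
    simpa using h⟩

/-- The set of points reachable by `ε`-chains is open. -/
theorem isOpen_setOf_eChain {X : Type*} [MetricSpace X] (f : X → X) (ε : ℝ) (p : X) :
    IsOpen {q | EChain f ε p q} := by
  rw [Metric.isOpen_iff]
  rintro q ⟨n, c, hn, h0, hc, hd⟩
  have hlast := hd (n - 1) (by omega)
  rw [Nat.sub_add_cancel hn, hc] at hlast
  refine ⟨ε - dist (f (c (n - 1))) q, by linarith, fun q' hq' => ?_⟩
  refine ⟨n, fun i => if i = n then q' else c i, hn, by simp [hn.ne, h0], by simp, ?_⟩
  intro i hi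
  rw [mem_ball, dist_comm] at hq'
  dsimp only
  rcases eq_or_ne (i + 1) n with h | h
  · obtain rfl : i = n - 1 := by omega
    rw [if_neg hi.ne, if_pos h]
    linarith [dist_triangle (f (c (n - 1))) q q']
  · rw [if_neg hi.ne, if_neg h]
    exact hd i hi

theorem image_closure_setOf_eChain_subset {X : Type*} [MetricSpace X] {f : X → X}
    (hf : Continuous f) {ε : ℝ} (hε : 0 < ε) (p : X) :
    f '' closure {q | EChain f ε p q} ⊆ {q | EChain f ε p q} := by
  rintro _ ⟨q, hq, rfl⟩
  have : f ⁻¹' ball (f q) ε ∈ nhds q :=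
    hf.continuousAt.preimage_mem_nhds (ball_mem_nhds _ hε)
  obtain ⟨q', hq', hmem⟩ := mem_closure_iff_nhds.1 hq _ this
  exact EChain.trans hmem (EChain.single hq')

/-- A boundary circle on which the map is a rigid rotation is chain transitive. -/
theorem eChain_of_rotation {f : Ann → Ann} {r : ℝ} {i : I01}
    (hf : ∀ x : ℝ, f ((x : S1), i) = (((x + r : ℝ) : S1), i)) {ε : ℝ} (hε : 0 < ε)
    (θ θ' : S1) : EChain f ε (θ, i) (θ', i) := by
  obtain ⟨x, rfl⟩ := QuotientAddGroup.mk_surjective θ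
  obtain ⟨y, rfl⟩ := QuotientAddGroup.mk_surjective θ'
  obtain ⟨n, hn⟩ := exists_nat_gt (1 / ε)
  have hn0 : (0 : ℝ) < n := (by positivity : (0 : ℝ) < 1 / ε).trans hn
  set δ := Int.fract (y - x - n * r) / n with hδ
  have hδ0 : 0 ≤ δ := div_nonneg (Int.fract_nonneg _) hn0.le
  have hδ1 : δ < ε := by
    rw [hδ, div_lt_iff₀ hn0]
    rw [div_lt_iff₀ hε] at hn
    linarith [Int.fract_lt_one (y - x - n * r)]
  refine ⟨n, fun j => (((x + j * (r + δ) : ℝ) : S1), i), by exact_mod_cast hn0, by simp, ?_, ?_⟩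
  · have e : x + n * (r + δ) = y - ⌊y - x - n * r⌋ := by
      have h1 : n * δ = Int.fract (y - x - n * r) := by
        rw [hδ]
        field_simp
      have h2 := Int.self_sub_floor (y - x - n * r)
      linarith
    have h0 : ((⌊y - x - n * r⌋ : ℝ) : S1) = 0 :=
      (AddCircle.coe_eq_zero_iff 1).2 ⟨⌊y - x - n * r⌋, by simp⟩
    dsimp only
    rw [e, AddCircle.coe_sub, h0, sub_zero]
  · intro j _
    rw [hf, Prod.dist_eq, dist_self, max_eq_left dist_nonneg]
    refine (dist_coe_le _ _).trans_lt ?_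
    have : x + j * (r + δ) + r - (x + ((j + 1 : ℕ) : ℝ) * (r + δ)) = -δ := by
      push_cast
      ring
    rwa [this, abs_neg, abs_of_nonneg hδ0]

/-- If a twist homeomorphism of the annulus with the intersection property is a
rigid rotation on each boundary circle (constant twist functions `r₀, r₁ > 0`),
then some chain transitive component of `ℛ(f)` meets both boundary circles. -/
theorem chainComponent_meets_both_boundaries (f : Ann ≃ₜ Ann)
    (F : (ℝ × I01) ≃ₜ (ℝ × I01)) (hF : IsLift ⇑f ⇑F)
    (r₀ r₁ : ℝ) (hr₀ : 0 < r₀) (hr₁ : 0 < r₁)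
    (hb1 : ∀ x : ℝ, F (x, iOne) = (x + r₁, iOne))
    (hb0 : ∀ x : ℝ, F (x, iZero) = (x - r₀, iZero))
    (hint : IntersectionProperty ⇑f) :
    ∃ p ∈ chainRecSet ⇑f,
      (chainComponent ⇑f p ∩ A0).Nonempty ∧ (chainComponent ⇑f p ∩ A1).Nonempty := by
  have rot1 : ∀ x : ℝ, f ((x : S1), iOne) = (((x + r₁ : ℝ) : S1), iOne) := fun x => by
    have := hF.1 (x, iOne)
    rw [hb1] at this
    exact this.symm
  have rot0 : ∀ x : ℝ, f ((x : S1), iZero) = (((x + -r₀ : ℝ) : S1), iZero) := fun x => by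
    have := hF.1 (x, iZero)
    rw [hb0] at this
    exact this.symm
  have chain1 : ∀ ε > 0, ∀ θ θ' : S1, EChain f ε (θ, iOne) (θ', iOne) :=
    fun ε hε => eChain_of_rotation rot1 hε
  have chain0 : ∀ ε > 0, ∀ θ θ' : S1, EChain f ε (θ, iZero) (θ', iZero) :=
    fun ε hε => eChain_of_rotation rot0 hε
  have sub : ∀ {ε : ℝ} {p : Ann} {i : I01} {r : ℝ},
      (∀ x : ℝ, f ((x : S1), i) = (((x + r : ℝ) : S1), i)) →
      (∀ θ, EChain f ε p (θ, i)) → {q : Ann | q.2 = i} ⊆ f '' closure {q | EChain f ε p q} := by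
    rintro ε p i r hr hp ⟨θ, _⟩ rfl
    obtain ⟨x, rfl⟩ := QuotientAddGroup.mk_surjective θ
    refine ⟨(((x - r : ℝ) : S1), _), subset_closure (hp _), ?_⟩
    rw [hr, sub_add_cancel]
  have up : ∀ ε > 0, EChain f ε ((0 : S1), iZero) ((0 : S1), iOne) := by
    intro ε hε
    by_contra hne
    refine hint.false_of_trapping f.continuous (isOpen_setOf_eChain f ε ((0 : S1), iZero))
      (image_closure_setOf_eChain_subset f.continuous hε _)
      (Or.inl ⟨sub rot0 (chain0 ε hε 0), ?_⟩)
    rintro ⟨θ, _⟩ rfl hθ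
    exact hne (EChain.trans hθ (chain1 ε hε θ 0))
  have down : ∀ ε > 0, EChain f ε ((0 : S1), iOne) ((0 : S1), iZero) := by
    intro ε hε
    by_contra hne
    refine hint.false_of_trapping f.continuous (isOpen_setOf_eChain f ε ((0 : S1), iOne))
      (image_closure_setOf_eChain_subset f.continuous hε _)
      (Or.inr ⟨sub rot1 (chain1 ε hε 0), ?_⟩)
    rintro ⟨θ, _⟩ rfl hθ
    exact hne (EChain.trans hθ (chain0 ε hε θ 0))
  have rec0 : ((0 : S1), iZero) ∈ chainRecSet f := fun ε hε => chain0 ε hε 0 0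
  have rec1 : ((0 : S1), iOne) ∈ chainRecSet f := fun ε hε => chain1 ε hε 0 0
  exact ⟨((0 : S1), iZero), rec0,
    ⟨_, ⟨rec0, rec0, fun ε hε => ⟨rec0 ε hε, rec0 ε hε⟩⟩, rfl⟩,
    ⟨_, ⟨rec0, rec1, fun ε hε => ⟨up ε hε, down ε hε⟩⟩, rfl⟩⟩
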